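/- arXiv:math/0412002 — 5 statements merged into one kernel-verified Lean document; each statement's English description precedes it below -/
import Mathlib

section
/- Let I ⊆ ℂ[x₀,x₁,x₂] be a Borel-fixed monomial ideal, let X be a minimal generator of I, and let j be the largest index such that x_j divides X. Let I′ be the ideal generated by the minimal generators of I other than X, together with the monomials x_t·X for all t with j ≤ t ≤ 2. Then the set of monomials belonging to I′ is exactly the set of monomials belonging to I with X removed; in particular, the colength of I′ equals the colength of I plus one. (This is the claim underlying the fact that applying a single Λ-rewriting rule to a Borel-fixed monomial ideal increases the degree of the associated subscheme by exactly one.) -/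
open MvPolynomial

/-- `e` is (the exponent vector of) a minimal generator of the ideal `I`:
the monomial `x^e` lies in `I`, but dividing by any variable that occurs in it
leaves `I`. -/
def IsMinGen (I : Ideal (MvPolynomial (Fin 3) ℂ)) (e : Fin 3 →₀ ℕ) : Prop :=
  monomial e (1 : ℂ) ∈ I ∧
    ∀ t : Fin 3, e t ≠ 0 → monomial (e - Finsupp.single t 1) (1 : ℂ) ∉ I

theorem monomial_mem_span_image_iff {σ R : Type*} [CommSemiring R] [Nontrivial R]
    (S : Set (σ →₀ ℕ)) (e : σ →₀ ℕ) :
    monomial e (1 : R) ∈ Ideal.span ((fun s => monomial s (1 : R)) '' S) ↔ ∃ s ∈ S, s ≤ e := by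
  classical
  rw [mem_ideal_span_monomial_image, support_monomial, if_neg one_ne_zero]
  simp

theorem monomial_mem_of_le {σ R : Type*} [CommSemiring R] {I : Ideal (MvPolynomial σ R)}
    {a b : σ →₀ ℕ} (hab : a ≤ b) (ha : monomial a (1 : R) ∈ I) : monomial b (1 : R) ∈ I := by
  have h : monomial b (1 : R) = monomial (b - a) 1 * monomial a 1 := by
    rw [monomial_mul, tsub_add_cancel_of_le hab, one_mul]
  rw [h]
  exact I.mul_mem_left _ ha

theorem exists_isMinGen_le {I : Ideal (MvPolynomial (Fin 3) ℂ)} (e : Fin 3 →₀ ℕ)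
    (he : monomial e (1 : ℂ) ∈ I) : ∃ g, IsMinGen I g ∧ g ≤ e := by
  induction e using WellFoundedLT.induction with
  | ind e ih =>
    by_cases h : IsMinGen I e
    · exact ⟨e, h, le_rfl⟩
    · obtain ⟨t, ht, hmem⟩ : ∃ t : Fin 3, e t ≠ 0 ∧
          monomial (e - Finsupp.single t 1) (1 : ℂ) ∈ I := by
        by_contra! hc
        exact h ⟨he, hc⟩
      have hlt : e - Finsupp.single t 1 < e := by
        refine lt_of_le_of_ne tsub_le_self fun heq => ?_
        have := DFunLike.congr_fun heq t
        simp only [Finsupp.tsub_apply, Finsupp.single_eq_same] at this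
        omega
      obtain ⟨g, hg, hge⟩ := ih _ hlt hmem
      exact ⟨g, hg, hge.trans hlt.le⟩

theorem add_single_le_of_lt {σ : Type*} {a b : σ →₀ ℕ} (hab : a ≤ b) {t : σ} (ht : a t < b t) :
    a + Finsupp.single t 1 ≤ b := by
  classical
  intro s
  have := hab s
  rw [Finsupp.add_apply, Finsupp.single_apply]
  split_ifs with h
  · subst h; omega
  · omega

theorem IsMinGen.eq_of_le {I : Ideal (MvPolynomial (Fin 3) ℂ)} {x g : Fin 3 →₀ ℕ}
    (hx : IsMinGen I x) (hg : monomial g (1 : ℂ) ∈ I) (hgx : g ≤ x) : g = x := by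
  by_contra hne
  obtain ⟨t, ht⟩ : ∃ t, g t < x t := by
    by_contra! hc
    exact hne (le_antisymm hgx hc)
  exact hx.2 t (by omega)
    (monomial_mem_of_le (le_tsub_of_add_le_right (add_single_le_of_lt hgx ht)) hg)

/-- Let `I ⊆ ℂ[x₀,x₁,x₂]` be a Borel-fixed monomial ideal, `X = x^x`
a minimal generator of `I`, and `j` the largest index such that `x_j` divides `X`.
Let `I′` be generated by the minimal generators of `I` other than `X`, together with
the monomials `x_t·X` for `j ≤ t ≤ 2`.  Then the monomials of `I′` are exactly those
of `I` with `X` removed; in particular the colength of `I′` is the colength of `I`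
plus one. -/
theorem stmt_1 (I : Ideal (MvPolynomial (Fin 3) ℂ))
    (G : Set (Fin 3 →₀ ℕ))
    (hI : I = Ideal.span ((fun e => monomial e (1 : ℂ)) '' G))
    (hBorel : ∀ e : Fin 3 →₀ ℕ, monomial e (1 : ℂ) ∈ I →
      ∀ i j : Fin 3, i < j → e j ≠ 0 →
        monomial (e - Finsupp.single j 1 + Finsupp.single i 1) (1 : ℂ) ∈ I)
    (x : Fin 3 →₀ ℕ) (hx : IsMinGen I x)
    (j : Fin 3) (hj : x j ≠ 0) (hjmax : ∀ t : Fin 3, j < t → x t = 0)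
    (I' : Ideal (MvPolynomial (Fin 3) ℂ))
    (hI' : I' = Ideal.span
      (((fun e => monomial e (1 : ℂ)) '' ({e | IsMinGen I e} \ {x})) ∪
        ((fun t => monomial (x + Finsupp.single t 1) (1 : ℂ)) '' {t : Fin 3 | j ≤ t}))) :
    {e : Fin 3 →₀ ℕ | monomial e (1 : ℂ) ∈ I'}
        = {e : Fin 3 →₀ ℕ | monomial e (1 : ℂ) ∈ I} \ {x} ∧
      {e : Fin 3 →₀ ℕ | monomial e (1 : ℂ) ∉ I'}.encard
        = {e : Fin 3 →₀ ℕ | monomial e (1 : ℂ) ∉ I}.encard + 1 := by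
  have hmem (e : Fin 3 →₀ ℕ) : monomial e (1 : ℂ) ∈ I' ↔
      (∃ g, IsMinGen I g ∧ g ≠ x ∧ g ≤ e) ∨ ∃ t, j ≤ t ∧ x + Finsupp.single t 1 ≤ e := by
    have himage : (fun t => monomial (x + Finsupp.single t 1) (1 : ℂ)) '' {t : Fin 3 | j ≤ t} =
        (fun e => monomial e (1 : ℂ)) '' ((fun t => x + Finsupp.single t 1) '' {t | j ≤ t}) := by
      rw [Set.image_image]
    rw [hI', himage, ← Set.image_union, monomial_mem_span_image_iff]
    simp [or_and_right, exists_or, and_assoc]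
  have hset : {e : Fin 3 →₀ ℕ | monomial e (1 : ℂ) ∈ I'}
      = {e : Fin 3 →₀ ℕ | monomial e (1 : ℂ) ∈ I} \ {x} := by
    ext e
    simp only [Set.mem_ofPred_eq, Set.mem_sdiff, Set.mem_singleton_iff, hmem]
    constructor
    · rintro (⟨g, hg, hne, hge⟩ | ⟨t, -, hte⟩)
      · refine ⟨monomial_mem_of_le hge hg.1, ?_⟩
        rintro rfl
        exact hne (hx.eq_of_le hg.1 hge)
      · refine ⟨monomial_mem_of_le (le_self_add.trans hte) hx.1, ?_⟩
        rintro rfl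
        have := hte t
        simp at this
    · rintro ⟨he, hne⟩
      obtain ⟨g, hg, hge⟩ := exists_isMinGen_le e he
      by_cases hgx : g = x
      · subst hgx
        obtain ⟨t, ht⟩ : ∃ t, g t < e t := by
          by_contra! hc
          exact hne (le_antisymm hc hge)
        have hgt := add_single_le_of_lt hge ht
        rcases le_or_gt j t with hjt | htj
        · exact Or.inr ⟨t, hjt, hgt⟩
        · obtain ⟨k, hk, hke⟩ := exists_isMinGen_le _ (hBorel g hg.1 t j htj hj)
          refine Or.inl ⟨k, hk, ?_, hke.trans ((add_le_add_left tsub_le_self _).trans hgt)⟩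
          rintro rfl
          have := hke j
          simp [htj.ne'] at this
          omega
      · exact Or.inl ⟨g, hg, hgx, hge⟩
  refine ⟨hset, ?_⟩
  have hcompl : {e : Fin 3 →₀ ℕ | monomial e (1 : ℂ) ∉ I'}
      = insert x {e : Fin 3 →₀ ℕ | monomial e (1 : ℂ) ∉ I} := by
    ext e
    have := Set.ext_iff.mp hset e
    simp only [Set.mem_ofPred_eq, Set.mem_sdiff, Set.mem_singleton_iff, Set.mem_insert_iff] at this ⊢
    tauto
  rw [hcompl, Set.encard_insert_of_notMem (by simpa using hx.1)]
end

section
/- Let I ⊆ ℂ[x₀,x₁,x₂] be a Borel-fixed monomial ideal of colength 10 that contains no monomial of degree 1 and is generated by the monomials of degree at most 4 that it contains. Then I contains at most three monomials of degree 2, and I is one of the following five ideals: (i) the ideal generated by all monomials of degree 3 (i.e. (x₀,x₁,x₂)³); (ii) (x₀², x₀x₁², x₀x₁x₂, x₀x₂², x₁³, x₁²x₂, x₁x₂², x₂⁴); (iii) (x₀², x₀x₁, x₀x₂², x₁³, x₁²x₂, x₁x₂³, x₂⁴); (iv) (x₀², x₀x₁, x₀x₂, x₁³, x₁²x₂²,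 x₁x₂³, x₂⁴); (v) (x₀², x₀x₁, x₁², x₀x₂³, x₁x₂³, x₂⁴). -/
open MvPolynomial

/-- The exponent vector `(a, b, c)` in three variables. -/
noncomputable def exponent (t : ℕ × ℕ × ℕ) : Fin 3 →₀ ℕ :=
  Finsupp.equivFunOnFinite.symm ![t.1, t.2.1, t.2.2]

theorem exponent_injective : Function.Injective exponent := by
  rintro ⟨a, b, c⟩ ⟨a', b', c'⟩ h
  have h0 := DFunLike.congr_fun h 0
  have h1 := DFunLike.congr_fun h 1
  have h2 := DFunLike.congr_fun h 2
  simp_all [exponent]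

theorem exponent_apply_self (e : Fin 3 →₀ ℕ) : exponent (e 0, e 1, e 2) = e := by
  ext i
  fin_cases i <;> simp [exponent]

theorem sum_exponent (t : ℕ × ℕ × ℕ) :
    ((exponent t).sum fun _ n => n) = t.1 + t.2.1 + t.2.2 := by
  simp [Finsupp.sum_fintype, Fin.sum_univ_three, exponent]

theorem monomial_exponent (t : ℕ × ℕ × ℕ) :
    monomial (exponent t) (1 : ℂ) = X 0 ^ t.1 * X 1 ^ t.2.1 * X 2 ^ t.2.2 := by
  simp [monomial_eq, Finsupp.prod_fintype, Fin.prod_univ_three, exponent]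

theorem exponent_le_exponent {s t : ℕ × ℕ × ℕ} (h : s ≤ t) : exponent s ≤ exponent t := by
  obtain ⟨h0, h1, h2⟩ := h
  intro i
  fin_cases i <;> simpa [exponent]

theorem monomial_mem_of_le_s2 {I : Ideal (MvPolynomial (Fin 3) ℂ)} {d e : Fin 3 →₀ ℕ}
    (h : d ≤ e) (hd : monomial d (1 : ℂ) ∈ I) : monomial e (1 : ℂ) ∈ I :=
  I.mem_of_dvd (monomial_dvd_monomial.2 ⟨Or.inr h, dvd_rfl⟩) hd

open Classical in
theorem ncard_setOf_exponent (F : Finset (ℕ × ℕ × ℕ)) (S : Set (Fin 3 →₀ ℕ))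
    (Q : (Fin 3 →₀ ℕ) → Prop)
    (hS : ∀ t, exponent t ∈ S ↔ t ∈ F ∧ Q (exponent t)) :
    S.ncard = ∑ t ∈ F, if Q (exponent t) then 1 else 0 := by
  have h : S = ((F.filter fun t => Q (exponent t)).image exponent : Finset (Fin 3 →₀ ℕ)) := by
    ext e
    rw [← exponent_apply_self e, hS]
    simp [exponent_injective.eq_iff]
  rw [h, Set.ncard_coe_finset, Finset.card_image_of_injective _ exponent_injective,
    Finset.card_filter]

/-- A monomial ideal is generated by a set `T` of its monomials as soon as every monomial is either
a multiple of a member of `T` or a divisor of a member of a set `M` of monomials outside the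
ideal. -/
theorem eq_span_of_forall_exists_le {I : Ideal (MvPolynomial (Fin 3) ℂ)} {G : Set (Fin 3 →₀ ℕ)}
    (hI : I = Ideal.span ((fun e => monomial e (1 : ℂ)) '' G))
    (T M : Set (ℕ × ℕ × ℕ)) (hT : ∀ t ∈ T, monomial (exponent t) (1 : ℂ) ∈ I)
    (hM : ∀ m ∈ M, monomial (exponent m) (1 : ℂ) ∉ I)
    (hcov : ∀ a b c, (∃ t ∈ T, t ≤ (a, b, c)) ∨ ∃ m ∈ M, (a, b, c) ≤ m) :
    I = Ideal.span
      ((fun t : ℕ × ℕ × ℕ => (X 0 ^ t.1 * X 1 ^ t.2.1 * X 2 ^ t.2.2 :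
        MvPolynomial (Fin 3) ℂ)) '' T) := by
  simp_rw [← monomial_exponent]
  apply le_antisymm
  · rw [hI, Ideal.span_le]
    rintro _ ⟨e, he, rfl⟩
    have heI : monomial e (1 : ℂ) ∈ I := hI ▸ Ideal.subset_span ⟨e, he, rfl⟩
    rw [← exponent_apply_self e] at heI ⊢
    obtain ⟨t, ht, hte⟩ | ⟨m, hm, hem⟩ := hcov (e 0) (e 1) (e 2)
    · exact monomial_mem_of_le_s2 (exponent_le_exponent hte) (Ideal.subset_span ⟨t, ht, rfl⟩)
    · exact absurd (monomial_mem_of_le_s2 (exponent_le_exponent hem) heI) (hM m hm)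
  · rw [Ideal.span_le]
    rintro _ ⟨t, ht, rfl⟩
    exact hT t ht

theorem pow_three_eq_span : (Ideal.span {X 0, X 1, X 2} : Ideal (MvPolynomial (Fin 3) ℂ)) ^ 3 =
    Ideal.span ((fun t : ℕ × ℕ × ℕ => (X 0 ^ t.1 * X 1 ^ t.2.1 * X 2 ^ t.2.2 :
      MvPolynomial (Fin 3) ℂ)) '' {t | t.1 + t.2.1 + t.2.2 = 3}) := by
  have hrange : ({X 0, X 1, X 2} : Set (MvPolynomial (Fin 3) ℂ)) = Set.range X := by
    ext p
    simp [Fin.exists_fin_succ, eq_comm]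
  rw [hrange]
  change idealOfVars (Fin 3) ℂ ^ 3 = _
  rw [pow_idealOfVars_eq_span]
  congr 1
  simp_rw [← monomial_exponent]
  ext p
  constructor
  · rintro ⟨e, he, rfl⟩
    refine ⟨(e 0, e 1, e 2), ?_, congrArg (monomial · 1) (exponent_apply_self e)⟩
    rw [← exponent_apply_self e] at he
    exact (sum_exponent _).symm.trans he
  · rintro ⟨t, ht, rfl⟩
    exact ⟨exponent t, (sum_exponent t).trans ht, rfl⟩

/-- A Borel-fixed set of exponents containing `(0, 0, n)` contains every exponent of degree at
least `n`. -/
theorem borel_of_le_sum {P : ℕ → ℕ → ℕ → Prop}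
    (hmul : ∀ {a b c a' b' c'}, P a b c → a ≤ a' → b ≤ b' → c ≤ c' → P a' b' c')
    (hB12 : ∀ {a b c}, P a b (c + 1) → P a (b + 1) c)
    (hB01 : ∀ {a b c}, P a (b + 1) c → P (a + 1) b c) {n : ℕ} (hn : P 0 0 n) {a b c : ℕ}
    (h : n ≤ a + b + c) : P a b c := by
  have hzero : ∀ b c, b + c = n → P 0 b c := by
    intro b
    induction b with
    | zero =>
      rintro c hc
      obtain rfl : c = n := by omega
      exact hn
    | succ b ih => exact fun c hc => hB12 (ih (c + 1) (by omega))
  have hall : ∀ a b c, a + b + c = n → P a b c := by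
    intro a
    induction a with
    | zero => exact fun b c h => hzero b c (by omega)
    | succ a ih => exact fun b c h => hB01 (ih (b + 1) c (by omega))
  exact hmul (hall (min a n) (min b (n - min a n)) (n - min a n - min b (n - min a n))
    (by omega)) (by omega) (by omega) (by omega)

open Classical in
/-- If a Borel-fixed set of exponents misses exactly six exponents of degree two or three, then its
members of degrees two and three follow one of five patterns. -/
theorem borel_cases {P : ℕ → ℕ → ℕ → Prop}
    (hz : ∀ {a b c}, P a b c → P a b (c + 1))
    (hB12 : ∀ {a b c}, P a b (c + 1) → P a (b + 1) c)
    (hB01 : ∀ {a b c}, P a (b + 1) c → P (a + 1) b c)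
    (hcard : ((if P 0 0 2 then 0 else 1) + (if P 0 1 1 then 0 else 1) +
      (if P 0 2 0 then 0 else 1) + (if P 1 0 1 then 0 else 1) +
      (if P 1 1 0 then 0 else 1) + (if P 2 0 0 then 0 else 1)) +
      ((if P 0 0 3 then 0 else 1) + (if P 0 1 2 then 0 else 1) +
      (if P 0 2 1 then 0 else 1) + (if P 0 3 0 then 0 else 1) +
      (if P 1 0 2 then 0 else 1) + (if P 1 1 1 then 0 else 1) +
      (if P 1 2 0 then 0 else 1) + (if P 2 0 1 then 0 else 1) +
      (if P 2 1 0 then 0 else 1) + (if P 3 0 0 then 0 else 1)) = 6) :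
      (¬ P 0 0 2 ∧ ¬ P 0 1 1 ∧ ¬ P 0 2 0 ∧ ¬ P 1 0 1 ∧ ¬ P 1 1 0 ∧ ¬ P 2 0 0 ∧ P 0 0 3 ∧
        P 0 1 2 ∧ P 0 2 1 ∧ P 0 3 0 ∧ P 1 0 2 ∧ P 1 1 1 ∧ P 1 2 0 ∧ P 2 0 1 ∧ P 2 1 0 ∧ P 3 0 0) ∨
      (¬ P 0 0 2 ∧ ¬ P 0 1 1 ∧ ¬ P 0 2 0 ∧ ¬ P 1 0 1 ∧ ¬ P 1 1 0 ∧ P 2 0 0 ∧ ¬ P 0 0 3 ∧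
        P 0 1 2 ∧ P 0 2 1 ∧ P 0 3 0 ∧ P 1 0 2 ∧ P 1 1 1 ∧ P 1 2 0) ∨
      (¬ P 0 0 2 ∧ ¬ P 0 1 1 ∧ ¬ P 0 2 0 ∧ ¬ P 1 0 1 ∧ P 1 1 0 ∧ P 2 0 0 ∧ ¬ P 0 0 3 ∧
        ¬ P 0 1 2 ∧ P 0 2 1 ∧ P 0 3 0 ∧ P 1 0 2) ∨
      (¬ P 0 0 2 ∧ ¬ P 0 1 1 ∧ ¬ P 0 2 0 ∧ P 1 0 1 ∧ P 1 1 0 ∧ P 2 0 0 ∧ ¬ P 0 0 3 ∧ ¬ P 0 1 2 ∧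
        ¬ P 0 2 1 ∧ P 0 3 0) ∨
      (¬ P 0 0 2 ∧ ¬ P 0 1 1 ∧ P 0 2 0 ∧ ¬ P 1 0 1 ∧ P 1 1 0 ∧ P 2 0 0 ∧ ¬ P 0 0 3 ∧ ¬ P 0 1 2 ∧
        ¬ P 1 0 2) := by
  have b002_011 : P 0 0 2 → P 0 1 1 := hB12
  have b011_020 : P 0 1 1 → P 0 2 0 := hB12
  have b011_101 : P 0 1 1 → P 1 0 1 := hB01
  have b020_110 : P 0 2 0 → P 1 1 0 := hB01
  have b101_110 : P 1 0 1 → P 1 1 0 := hB12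
  have b110_200 : P 1 1 0 → P 2 0 0 := hB01
  have b003_012 : P 0 0 3 → P 0 1 2 := hB12
  have b012_021 : P 0 1 2 → P 0 2 1 := hB12
  have b012_102 : P 0 1 2 → P 1 0 2 := hB01
  have b021_030 : P 0 2 1 → P 0 3 0 := hB12
  have b021_111 : P 0 2 1 → P 1 1 1 := hB01
  have b102_111 : P 1 0 2 → P 1 1 1 := hB12
  have b030_120 : P 0 3 0 → P 1 2 0 := hB01
  have b111_120 : P 1 1 1 → P 1 2 0 := hB12
  have b111_201 : P 1 1 1 → P 2 0 1 := hB01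
  have b120_210 : P 1 2 0 → P 2 1 0 := hB01
  have b201_210 : P 2 0 1 → P 2 1 0 := hB12
  have b210_300 : P 2 1 0 → P 3 0 0 := hB01
  have m002_003 : P 0 0 2 → P 0 0 3 := hz
  have m011_012 : P 0 1 1 → P 0 1 2 := hz
  have m020_021 : P 0 2 0 → P 0 2 1 := hz
  have m101_102 : P 1 0 1 → P 1 0 2 := hz
  have m110_111 : P 1 1 0 → P 1 1 1 := hz
  have m200_201 : P 2 0 0 → P 2 0 1 := hz
  clear hz hB12 hB01
  by_cases p200 : P 2 0 0
  · by_cases p110 : P 1 1 0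
    · by_cases p101 : P 1 0 1
      · by_cases p020 : P 0 2 0
        · exfalso
          grind
        · right; right; right; left
          have p011 := mt b011_020 p020
          have p002 := mt b002_011 p011
          simp only [p200, p110, p101, p020, p011, p002, if_true, if_false] at hcard ⊢
          grind
      · have p011 := mt b011_101 p101
        have p002 := mt b002_011 p011
        by_cases p020 : P 0 2 0
        · right; right; right; right
          simp only [p200, p110, p101, p020, p011, p002, if_true, if_false] at hcard ⊢
          grind
        · right; right; left
          simp only [p200, p110, p101, p020, p011, p002, if_true, if_false] at hcard ⊢
          grind
    · right; left
      have p101 := mt b101_110 p110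
      have p020 := mt b020_110 p110
      have p011 := mt b011_020 p020
      have p002 := mt b002_011 p011
      simp only [p200, p110, p101, p020, p011, p002, if_true, if_false] at hcard ⊢
      grind
  · left
    have p110 := mt b110_200 p200
    have p101 := mt b101_110 p110
    have p020 := mt b020_110 p110
    have p011 := mt b011_020 p020
    have p002 := mt b002_011 p011
    simp only [p200, p110, p101, p020, p011, p002, if_false] at hcard ⊢
    grind

/-- Let `I ⊆ ℂ[x₀,x₁,x₂]` be a Borel-fixed monomial ideal of
colength 10, containing no monomial of degree 1 and generated by the monomials of
degree at most 4 that it contains.  Then `I` contains at most three monomials of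
degree 2 and is one of five explicit ideals. -/
theorem stmt_2 (I : Ideal (MvPolynomial (Fin 3) ℂ))
    (G : Set (Fin 3 →₀ ℕ))
    (hI : I = Ideal.span ((fun e => monomial e (1 : ℂ)) '' G))
    (hBorel : ∀ e : Fin 3 →₀ ℕ, monomial e (1 : ℂ) ∈ I →
      ∀ i j : Fin 3, i < j → e j ≠ 0 →
        monomial (e - Finsupp.single j 1 + Finsupp.single i 1) (1 : ℂ) ∈ I)
    (hcolen : {e : Fin 3 →₀ ℕ | monomial e (1 : ℂ) ∉ I}.ncard = 10)
    (hdeg1 : ∀ e : Fin 3 →₀ ℕ, (e.sum fun _ n => n) = 1 → monomial e (1 : ℂ) ∉ I)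
    (hgen4 : I = Ideal.span
      ((fun e => monomial e (1 : ℂ)) ''
        {e : Fin 3 →₀ ℕ | (e.sum fun _ n => n) ≤ 4 ∧ monomial e (1 : ℂ) ∈ I})) :
    {e : Fin 3 →₀ ℕ | (e.sum fun _ n => n) = 2 ∧ monomial e (1 : ℂ) ∈ I}.ncard ≤ 3 ∧
      (I = (Ideal.span {X 0, X 1, X 2}) ^ 3 ∨
        I = Ideal.span {X 0 ^ 2, X 0 * X 1 ^ 2, X 0 * X 1 * X 2, X 0 * X 2 ^ 2,
              X 1 ^ 3, X 1 ^ 2 * X 2, X 1 * X 2 ^ 2, X 2 ^ 4} ∨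
        I = Ideal.span {X 0 ^ 2, X 0 * X 1, X 0 * X 2 ^ 2,
              X 1 ^ 3, X 1 ^ 2 * X 2, X 1 * X 2 ^ 3, X 2 ^ 4} ∨
        I = Ideal.span {X 0 ^ 2, X 0 * X 1, X 0 * X 2,
              X 1 ^ 3, X 1 ^ 2 * X 2 ^ 2, X 1 * X 2 ^ 3, X 2 ^ 4} ∨
        I = Ideal.span {X 0 ^ 2, X 0 * X 1, X 1 ^ 2,
              X 0 * X 2 ^ 3, X 1 * X 2 ^ 3, X 2 ^ 4}) := by
  set P : ℕ → ℕ → ℕ → Prop := fun a b c => monomial (exponent (a, b, c)) (1 : ℂ) ∈ I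
  have hmul : ∀ {a b c a' b' c'}, P a b c → a ≤ a' → b ≤ b' → c ≤ c' → P a' b' c' :=
    fun h h0 h1 h2 => monomial_mem_of_le_s2 (exponent_le_exponent ⟨h0, h1, h2⟩) h
  have hB12 : ∀ {a b c}, P a b (c + 1) → P a (b + 1) c := by
    intro a b c h
    have heq : exponent (a, b, c + 1) - Finsupp.single 2 1 + Finsupp.single 1 1 =
        exponent (a, b + 1, c) := by
      ext i
      fin_cases i <;> simp [exponent, Matrix.vecHead, Matrix.vecTail]
    have hmem := hBorel _ h 1 2 (by decide) (by simp [exponent])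
    rwa [heq] at hmem
  have hB01 : ∀ {a b c}, P a (b + 1) c → P (a + 1) b c := by
    intro a b c h
    have heq : exponent (a, b + 1, c) - Finsupp.single 1 1 + Finsupp.single 0 1 =
        exponent (a + 1, b, c) := by
      ext i
      fin_cases i <;> simp [exponent, Matrix.vecHead, Matrix.vecTail]
    have hmem := hBorel _ h 0 1 (by decide) (by simp [exponent])
    rwa [heq] at hmem
  have hfin : {e : Fin 3 →₀ ℕ | monomial e (1 : ℂ) ∉ I}.Finite :=
    Set.finite_of_ncard_ne_zero (by omega)
  have h004 : P 0 0 4 := by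
    obtain ⟨n, hn⟩ : ∃ n, P 0 0 n := by
      by_contra! h
      have hinj : Function.Injective fun n : ℕ => exponent (0, 0, n) := fun m n hmn => by
        simpa using exponent_injective hmn
      exact Set.infinite_of_injective_forall_mem hinj h hfin
    have hn' : monomial (exponent (0, 0, n)) (1 : ℂ) ∈ I := hn
    rw [hgen4, mem_ideal_span_monomial_image] at hn'
    obtain ⟨d, ⟨hd, hdI⟩, hle⟩ := hn' (exponent (0, 0, n)) (by simp)
    rw [← exponent_apply_self d] at hd hdI
    rw [sum_exponent] at hd
    have h0 : d 0 = 0 := by simpa [exponent] using hle 0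
    have h1 : d 1 = 0 := by simpa [exponent] using hle 1
    rw [h0, h1] at hd hdI
    exact hmul (show P 0 0 (d 2) from hdI) le_rfl le_rfl (by simpa using hd)
  have hdeg4 : ∀ a b c, 4 ≤ a + b + c → P a b c := fun _ _ _ =>
    borel_of_le_sum hmul hB12 hB01 h004
  have hdeg1' : ∀ a b c, a + b + c = 1 → ¬ P a b c := fun a b c h =>
    hdeg1 _ (by simpa [sum_exponent] using h)
  have n100 := hdeg1' 1 0 0 rfl
  have n010 := hdeg1' 0 1 0 rfl
  have n001 := hdeg1' 0 0 1 rfl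
  have n000 : ¬ P 0 0 0 := fun h => n001 (hmul h le_rfl le_rfl zero_le_one)
  classical
  have hcard := ncard_setOf_exponent
    (((Finset.range 4) ×ˢ (Finset.range 4) ×ˢ (Finset.range 4)).filter
      fun t => t.1 + t.2.1 + t.2.2 ≤ 3)
    {e : Fin 3 →₀ ℕ | monomial e (1 : ℂ) ∉ I} (fun e => monomial e (1 : ℂ) ∉ I) (by
      rintro ⟨a, b, c⟩
      have := hdeg4 a b c
      simp only [Set.mem_ofPred_eq, Finset.mem_filter, Finset.mem_product, Finset.mem_range]
      refine ⟨fun h => ⟨?_, h⟩, fun h => h.2⟩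
      have : ¬ 4 ≤ a + b + c := fun h' => h (this h')
      omega)
  have hcard2 := ncard_setOf_exponent
    (((Finset.range 3) ×ˢ (Finset.range 3) ×ˢ (Finset.range 3)).filter
      fun t => t.1 + t.2.1 + t.2.2 = 2)
    {e : Fin 3 →₀ ℕ | (e.sum fun _ n => n) = 2 ∧ monomial e (1 : ℂ) ∈ I}
    (fun e => monomial e (1 : ℂ) ∈ I) (by
      rintro ⟨a, b, c⟩
      simp only [Set.mem_ofPred_eq, Finset.mem_filter, Finset.mem_product, Finset.mem_range,
        sum_exponent]
      refine and_congr_left fun _ => ?_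
      omega)
  rw [hcolen] at hcard
  simp only [Finset.sum_filter, Finset.sum_product, Finset.sum_range_succ,
    Finset.sum_range_zero] at hcard hcard2
  have hPd : ∀ a b c, (monomial (exponent (a, b, c)) (1 : ℂ) ∈ I) = P a b c := fun _ _ _ => rfl
  simp [hPd, n000, n100, n010, n001] at hcard hcard2
  have hcases := borel_cases (P := P) (fun h => hmul h le_rfl le_rfl (by omega)) hB12 hB01
    (by omega)
  rw [hcard2]
  clear hcard hcard2
  rcases hcases with h | h | h | h | h
  · obtain ⟨p002, p011, p020, p101, p110, p200, p003, p012, p021, p030, p102, p111, p120, p201,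
      p210, p300⟩ := h
    refine ⟨by simp [p002, p011, p020, p101, p110, p200], Or.inl ?_⟩
    rw [pow_three_eq_span]
    refine eq_span_of_forall_exists_le hI _ {t | t.1 + t.2.1 + t.2.2 = 2} ?_ ?_ ?_
    · rintro ⟨a, b, c⟩ (h : a + b + c = 3)
      change P a b c
      have ha : a ≤ 3 := by omega
      have hb : b ≤ 3 := by omega
      obtain rfl : c = 3 - a - b := by omega
      interval_cases a <;> interval_cases b <;> first | assumption | omega
    · rintro ⟨a, b, c⟩ (h : a + b + c = 2)
      change ¬ P a b c
      have ha : a ≤ 2 := by omega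
      have hb : b ≤ 2 := by omega
      obtain rfl : c = 2 - a - b := by omega
      interval_cases a <;> interval_cases b <;> first | assumption | omega
    · intro a b c
      rcases lt_or_ge 2 (a + b + c) with h | h
      · exact Or.inl ⟨(min a 3, min b (3 - min a 3), 3 - min a 3 - min b (3 - min a 3)),
          show _ + _ + _ = 3 by dsimp only; omega, by
            refine ⟨?_, ?_, ?_⟩ <;> dsimp only <;> omega⟩
      · exact Or.inr ⟨(a, b, 2 - a - b), show _ + _ + _ = 2 by dsimp only; omega, by
          refine ⟨?_, ?_, ?_⟩ <;> dsimp only <;> omega⟩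
  · obtain ⟨p002, p011, p020, p101, p110, p200, p003, p012, p021, p030, p102, p111, p120⟩ := h
    refine ⟨by simp [p002, p011, p020, p101, p110, p200], Or.inr (Or.inl ?_)⟩
    rw [eq_span_of_forall_exists_le hI
      {(2, 0, 0), (1, 2, 0), (1, 1, 1), (1, 0, 2), (0, 3, 0), (0, 2, 1), (0, 1, 2), (0, 0, 4)}
      {(1, 1, 0), (1, 0, 1), (0, 2, 0), (0, 1, 1), (0, 0, 3)} ?_ ?_ ?_]
    · simp [Set.image_insert_eq]
    · simp [hPd, hdeg4, p200, p120, p111, p102, p030, p021, p012]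
    · simp [hPd, p110, p101, p020, p011, p003]
    · simp only [Set.mem_insert_iff, Set.mem_singleton_iff, exists_eq_or_imp, exists_eq_left,
        Prod.mk_le_mk]
      omega
  · obtain ⟨p002, p011, p020, p101, p110, p200, p003, p012, p021, p030, p102⟩ := h
    refine ⟨by simp [p002, p011, p020, p101, p110, p200], Or.inr (Or.inr (Or.inl ?_))⟩
    rw [eq_span_of_forall_exists_le hI
      {(2, 0, 0), (1, 1, 0), (1, 0, 2), (0, 3, 0), (0, 2, 1), (0, 1, 3), (0, 0, 4)}
      {(1, 0, 1), (0, 2, 0), (0, 0, 3), (0, 1, 2)} ?_ ?_ ?_]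
    · simp [Set.image_insert_eq]
    · simp [hPd, hdeg4, p200, p110, p102, p030, p021]
    · simp [hPd, p101, p020, p003, p012]
    · simp only [Set.mem_insert_iff, Set.mem_singleton_iff, exists_eq_or_imp, exists_eq_left,
        Prod.mk_le_mk]
      omega
  · obtain ⟨p002, p011, p020, p101, p110, p200, p003, p012, p021, p030⟩ := h
    refine ⟨by simp [p002, p011, p020, p101, p110, p200], Or.inr (Or.inr (Or.inr (Or.inl ?_)))⟩
    rw [eq_span_of_forall_exists_le hI
      {(2, 0, 0), (1, 1, 0), (1, 0, 1), (0, 3, 0), (0, 2, 2), (0, 1, 3), (0, 0, 4)}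
      {(1, 0, 0), (0, 0, 3), (0, 1, 2), (0, 2, 1)} ?_ ?_ ?_]
    · simp [Set.image_insert_eq]
    · simp [hPd, hdeg4, p200, p110, p101, p030]
    · simp [hPd, n100, p003, p012, p021]
    · simp only [Set.mem_insert_iff, Set.mem_singleton_iff, exists_eq_or_imp, exists_eq_left,
        Prod.mk_le_mk]
      omega
  · obtain ⟨p002, p011, p020, p101, p110, p200, p003, p012, p102⟩ := h
    refine ⟨by simp [p002, p011, p020, p101, p110, p200], Or.inr (Or.inr (Or.inr (Or.inr ?_)))⟩
    rw [eq_span_of_forall_exists_le hI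
      {(2, 0, 0), (1, 1, 0), (0, 2, 0), (1, 0, 3), (0, 1, 3), (0, 0, 4)}
      {(0, 0, 3), (0, 1, 2), (1, 0, 2)} ?_ ?_ ?_]
    · simp [Set.image_insert_eq]
    · simp [hPd, hdeg4, p200, p110, p020]
    · simp [hPd, p003, p012, p102]
    · simp only [Set.mem_insert_iff, Set.mem_singleton_iff, exists_eq_or_imp, exists_eq_left,
        Prod.mk_le_mk]
      omega
end

section
/- Work in ℂ[x₀,x₁,x₂,x₃,x₄]. Let f be a homogeneous polynomial of degree 5 each of whose monomials involves only the variables x₀, x₁, x₂ and whose coefficient of x₂⁵ is zero, and let g be a homogeneous polynomial of degree 5 each of whose monomials involves only the variables x₂, x₃, x₄ and whose coefficient of x₂⁵ is zero. Then the intersection of the ideals (x₃, x₄, f) and (x₀, x₁, g) equals the ideal (x₀x₃, x₀x₄, x₁x₃, x₁x₄, f, g). (This computes the homogeneous ideal of the union of a plane quintic in the plane {x₃ = x₄ = 0} and a plane quintic in the plane {x₀ = x₁ = 0}, the two planes meeting at the point (0,0,1,0,0).) -/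
open MvPolynomial

/-- The intersection of two ideals, generated by disjoint pairs of variables, is contained in the
ideal generated by the products of variables from the two pairs. -/
theorem span_X_pair_inf_span_X_pair {σ R : Type*} [CommRing R] {a b c d : σ}
    (hac : a ≠ c) (had : a ≠ d) (hbc : b ≠ c) (hbd : b ≠ d) :
    Ideal.span {X a, X b} ⊓ Ideal.span {X c, X d} ≤
      (Ideal.span {X c * X a, X c * X b, X d * X a, X d * X b} : Ideal (MvPolynomial σ R)) := by
  classical
  rintro p ⟨h₁, h₂⟩
  have h_products : ({X c * X a, X c * X b, X d * X a, X d * X b} : Set (MvPolynomial σ R)) =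
      (fun s => monomial s (1 : R)) '' {.single c 1 + .single a 1, .single c 1 + .single b 1,
        .single d 1 + .single a 1, .single d 1 + .single b 1} := by
    simp [Set.image_insert_eq, X, monomial_mul]
  have single_add_le {i j : σ} {m : σ →₀ ℕ} (hij : j ≠ i) (hi : m i ≠ 0) (hj : m j ≠ 0) :
      Finsupp.single i 1 + Finsupp.single j 1 ≤ m := by
    intro k
    by_cases hki : k = i
    · subst hki
      simp [hij]
      omega
    · by_cases hkj : k = j
      · subst hkj
        simp [hij.symm]
        omega
      · simp [Ne.symm hki, Ne.symm hkj]
  rw [SetLike.mem_coe, ← Set.image_pair, mem_ideal_span_X_image] at h₁ h₂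
  rw [h_products, mem_ideal_span_monomial_image]
  intro m hm
  obtain ⟨i, rfl | rfl, hi⟩ := h₁ m hm <;> obtain ⟨j, rfl | rfl, hj⟩ := h₂ m hm
  · exact ⟨_, by simp, single_add_le hac hj hi⟩
  · exact ⟨_, by simp, single_add_le had hj hi⟩
  · exact ⟨_, by simp, single_add_le hbc hj hi⟩
  · exact ⟨_, by simp, single_add_le hbd hj hi⟩

/-- A homogeneous polynomial without a pure power of `X k`, whose monomials only involve `X a`,
`X b` and `X k`, lies in the ideal generated by `X a` and `X b`. -/
theorem mem_span_X_pair_of_isHomogeneous {σ R : Type*} [CommRing R] {a b k : σ} {n : ℕ}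
    {p : MvPolynomial σ R} (hp : p.IsHomogeneous n)
    (hvars : ∀ m ∈ p.support, ∀ i, i ≠ a → i ≠ b → i ≠ k → m i = 0)
    (hk : coeff (Finsupp.single k n) p = 0) :
    p ∈ Ideal.span {X a, X b} := by
  rw [← Set.image_pair, mem_ideal_span_X_image]
  intro m hm
  by_contra! h
  have ha : m a = 0 := h a (by simp)
  have hb : m b = 0 := h b (by simp)
  have h_single : m = Finsupp.single k (m k) := by
    ext i
    by_cases hik : i = k
    · simp [hik]
    · rw [Finsupp.single_eq_of_ne hik]
      by_cases hia : i = a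
      · rwa [hia]
      · by_cases hib : i = b
        · rwa [hib]
        · exact hvars m hm i hia hib hik
  have hdeg : m.degree = n := by
    rw [Finsupp.degree_eq_weight_one]
    exact hp (mem_support_iff.mp hm)
  rw [h_single, Finsupp.degree_single] at hdeg
  rw [hdeg] at h_single
  exact mem_support_iff.mp hm (h_single ▸ hk)

/-- In `ℂ[x₀,…,x₄]`, let `f` be homogeneous of degree 5 in the
variables `x₀,x₁,x₂` only, with zero coefficient of `x₂⁵`, and let `g` be
homogeneous of degree 5 in `x₂,x₃,x₄` only, with zero coefficient of `x₂⁵`.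
Then `(x₃, x₄, f) ∩ (x₀, x₁, g) = (x₀x₃, x₀x₄, x₁x₃, x₁x₄, f, g)`. -/
theorem stmt_11 (f g : MvPolynomial (Fin 5) ℂ)
    (hf5 : f.IsHomogeneous 5)
    (hfvars : ∀ e ∈ f.support, e 3 = 0 ∧ e 4 = 0)
    (hfx2 : coeff (Finsupp.single 2 5) f = 0)
    (hg5 : g.IsHomogeneous 5)
    (hgvars : ∀ e ∈ g.support, e 0 = 0 ∧ e 1 = 0)
    (hgx2 : coeff (Finsupp.single 2 5) g = 0) :
    Ideal.span {X 3, X 4, f} ⊓ Ideal.span {X 0, X 1, g}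
      = Ideal.span {X 0 * X 3, X 0 * X 4, X 1 * X 3, X 1 * X 4, f, g} := by
  have hf : f ∈ Ideal.span {X 0, X 1} :=
    mem_span_X_pair_of_isHomogeneous hf5 (fun m hm i h₀ h₁ h₂ => by
      have := hfvars m hm
      fin_cases i <;> simp_all) hfx2
  have hg : g ∈ Ideal.span {X 3, X 4} :=
    mem_span_X_pair_of_isHomogeneous hg5 (fun m hm i h₀ h₁ h₂ => by
      have := hgvars m hm
      fin_cases i <;> simp_all) hgx2
  have hf_span := (Ideal.span_singleton_le_iff_mem _).mpr hf
  have hg_span := (Ideal.span_singleton_le_iff_mem _).mpr hg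
  have h_triple (a b c : MvPolynomial (Fin 5) ℂ) :
      Ideal.span {a, b, c} = Ideal.span {c} ⊔ Ideal.span {a, b} := by
    rw [← Ideal.span_union]
    congr 1
    ext
    simp
  apply le_antisymm
  · rw [h_triple, h_triple, sup_inf_assoc_of_le _ (hf_span.trans le_sup_right), inf_comm,
      sup_inf_assoc_of_le _ hg_span, inf_comm (Ideal.span {X 0, X 1})]
    refine sup_le (Ideal.span_mono (by simp)) (sup_le (Ideal.span_mono (by simp)) ?_)
    refine (span_X_pair_inf_span_X_pair (by decide) (by decide) (by decide) (by decide)).trans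
      (Ideal.span_mono ?_)
    rintro _ (rfl | rfl | rfl | rfl) <;> simp
  · have mem_left {p} (hp : p ∈ ({X 3, X 4, f} : Set (MvPolynomial (Fin 5) ℂ))) :=
      Ideal.subset_span hp
    have mem_right {p} (hp : p ∈ ({X 0, X 1, g} : Set (MvPolynomial (Fin 5) ℂ))) :=
      Ideal.subset_span hp
    rw [Ideal.span_le]
    rintro _ (rfl | rfl | rfl | rfl | rfl | rfl)
    · exact ⟨Ideal.mul_mem_left _ _ (mem_left (by simp)),
        Ideal.mul_mem_right _ _ (mem_right (by simp))⟩
    · exact ⟨Ideal.mul_mem_left _ _ (mem_left (by simp)),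
        Ideal.mul_mem_right _ _ (mem_right (by simp))⟩
    · exact ⟨Ideal.mul_mem_left _ _ (mem_left (by simp)),
        Ideal.mul_mem_right _ _ (mem_right (by simp))⟩
    · exact ⟨Ideal.mul_mem_left _ _ (mem_left (by simp)),
        Ideal.mul_mem_right _ _ (mem_right (by simp))⟩
    · exact ⟨mem_left (by simp), h_triple _ _ g ▸ Ideal.mem_sup_right hf⟩
    · exact ⟨h_triple _ _ f ▸ Ideal.mem_sup_right hg, mem_right (by simp)⟩
end

section
/- Work in ℂ[x₀,x₁,x₂,x₃,x₄] with the degree reverse lexicographic monomial order (x₀ > x₁ > x₂ > x₃ > x₄). Let f be a nonzero homogeneous polynomial of degree 5 each of whose monomials involves only the variables x₀, x₁, x₂ and whose coefficient of x₂⁵ is zero. Then the initial ideal of the ideal (x₁x₄, x₀x₄, x₁x₃, x₀x₃, f) equals the ideal (x₁x₄, x₀x₄, x₁x₃, x₀x₃, lm(f)), where lm(f) is the leading monomial of f. -/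
open MvPolynomial

/-- Degree reverse lexicographic order on exponent vectors (with `x₀ > x₁ > ⋯ > x₄`):
`a < b` iff `a` has smaller total degree, or the degrees agree and at the largest
index where they differ, `a` has the larger exponent. -/
def RevLexLT (a b : Fin 5 →₀ ℕ) : Prop :=
  (a.sum fun _ n => n) < (b.sum fun _ n => n) ∨
    ((a.sum fun _ n => n) = (b.sum fun _ n => n) ∧
      ∃ i : Fin 5, b i < a i ∧ ∀ j : Fin 5, i < j → a j = b j)

/-- `d` is the exponent vector of the leading monomial of `h` for the degrevlex order. -/
def IsLeadExp (h : MvPolynomial (Fin 5) ℂ) (d : Fin 5 →₀ ℕ) : Prop :=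
  d ∈ h.support ∧ ∀ e ∈ h.support, e ≠ d → RevLexLT e d

/-- The initial ideal of `I` for the degrevlex order: the ideal generated by the
leading monomials of the nonzero elements of `I`. -/
noncomputable def initialIdeal (I : Ideal (MvPolynomial (Fin 5) ℂ)) : Ideal (MvPolynomial (Fin 5) ℂ) :=
  Ideal.span {p | ∃ h ∈ I, ∃ d : Fin 5 →₀ ℕ, IsLeadExp h d ∧ p = monomial d (1 : ℂ)}

theorem revLexLT_iff (a b : Fin 5 →₀ ℕ) :
    RevLexLT a b ↔
      a 0 + a 1 + a 2 + a 3 + a 4 < b 0 + b 1 + b 2 + b 3 + b 4 ∨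
      (a 0 + a 1 + a 2 + a 3 + a 4 = b 0 + b 1 + b 2 + b 3 + b 4 ∧
        (b 4 < a 4 ∨ (a 4 = b 4 ∧ (b 3 < a 3 ∨ (a 3 = b 3 ∧ (b 2 < a 2 ∨ (a 2 = b 2 ∧
          (b 1 < a 1 ∨ (a 1 = b 1 ∧ b 0 < a 0))))))))) := by
  have hs (c : Fin 5 →₀ ℕ) : (c.sum fun _ n => n) = c 0 + c 1 + c 2 + c 3 + c 4 := by
    rw [Finsupp.sum_fintype _ _ (fun _ => rfl), Fin.sum_univ_five]
  simp only [RevLexLT, hs, Fin.exists_fin_succ, Fin.forall_fin_succ]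
  simp [Fin.lt_def]
  omega

theorem revLexLT_asymm {a b : Fin 5 →₀ ℕ} (h : RevLexLT a b) : ¬ RevLexLT b a := by
  rw [revLexLT_iff] at *
  omega

theorem RevLexLT.trans {a b c : Fin 5 →₀ ℕ} (h : RevLexLT a b) (h' : RevLexLT b c) :
    RevLexLT a c := by
  rw [revLexLT_iff] at *
  omega

theorem RevLexLT.add_left {a b : Fin 5 →₀ ℕ} (h : RevLexLT a b) (c : Fin 5 →₀ ℕ) :
    RevLexLT (c + a) (c + b) := by
  rw [revLexLT_iff] at *
  simp only [Finsupp.add_apply]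
  omega

theorem RevLexLT.add_right {a b : Fin 5 →₀ ℕ} (h : RevLexLT a b) (c : Fin 5 →₀ ℕ) :
    RevLexLT (a + c) (b + c) := by
  rw [add_comm a, add_comm b]
  exact h.add_left c

theorem revLexLT_trichotomy (a b : Fin 5 →₀ ℕ) : RevLexLT a b ∨ a = b ∨ RevLexLT b a := by
  have h : a = b ↔ a 0 = b 0 ∧ a 1 = b 1 ∧ a 2 = b 2 ∧ a 3 = b 3 ∧ a 4 = b 4 := by
    rw [Finsupp.ext_iff]
    simp [Fin.forall_fin_succ]
  rw [h, revLexLT_iff, revLexLT_iff]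
  omega

theorem exists_isLeadExp {g : MvPolynomial (Fin 5) ℂ} (hg : g ≠ 0) : ∃ e, IsLeadExp g e := by
  have key (s : Finset (Fin 5 →₀ ℕ)) (hs : s.Nonempty) :
      ∃ e ∈ s, ∀ u ∈ s, u ≠ e → RevLexLT u e := by
    induction hs using Finset.Nonempty.cons_induction with
    | singleton a => simp
    | cons a s ha hs ih =>
      obtain ⟨e, he, hmax⟩ := ih
      rcases revLexLT_trichotomy a e with h | h | h
      · refine ⟨e, by simp [he], fun u hu hue => ?_⟩
        rcases Finset.mem_cons.mp hu with rfl | hu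
        · exact h
        · exact hmax u hu hue
      · exact absurd (h ▸ he) ha
      · refine ⟨a, by simp, fun u hu hua => ?_⟩
        rcases Finset.mem_cons.mp hu with rfl | hu
        · exact absurd rfl hua
        · by_cases hue : u = e
          · exact hue ▸ h
          · exact (hmax u hu hue).trans h
  exact key g.support (support_nonempty.mpr hg)

theorem IsLeadExp.add_lt {f g : MvPolynomial (Fin 5) ℂ} {a b u v : Fin 5 →₀ ℕ}
    (hf : IsLeadExp f a) (hg : IsLeadExp g b) (hu : u ∈ f.support) (hv : v ∈ g.support)
    (h : ¬ (u = a ∧ v = b)) : RevLexLT (u + v) (a + b) := by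
  by_cases hua : u = a
  · subst hua
    exact (hg.2 v hv fun hvb => h ⟨rfl, hvb⟩).add_left u
  · by_cases hvb : v = b
    · subst hvb
      exact (hf.2 u hu hua).add_right v
    · exact ((hf.2 u hu hua).add_right v).trans ((hg.2 v hv hvb).add_left a)

theorem IsLeadExp.mul {f g : MvPolynomial (Fin 5) ℂ} {a b : Fin 5 →₀ ℕ}
    (hf : IsLeadExp f a) (hg : IsLeadExp g b) : IsLeadExp (f * g) (a + b) := by
  classical
  constructor
  · have hc : coeff (a + b) (f * g) = coeff a f * coeff b g := by
      rw [coeff_mul]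
      refine Finset.sum_eq_single (a, b) ?_ ?_
      · rintro ⟨u, v⟩ huv hne
        by_contra h0
        have hlt := hf.add_lt hg (mem_support_iff.mpr (left_ne_zero_of_mul h0))
          (mem_support_iff.mpr (right_ne_zero_of_mul h0)) fun h => hne (Prod.ext h.1 h.2)
        rw [Finset.HasAntidiagonal.mem_antidiagonal.mp huv] at hlt
        exact revLexLT_asymm hlt hlt
      · intro h
        simp at h
    rw [mem_support_iff, hc]
    exact mul_ne_zero (mem_support_iff.mp hf.1) (mem_support_iff.mp hg.1)
  · intro e he hne
    obtain ⟨u, hu, v, hv, rfl⟩ := Finset.mem_add.mp (support_mul f g he)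
    exact hf.add_lt hg hu hv fun h => hne (by rw [h.1, h.2])

theorem isLeadExp_monomial (d : Fin 5 →₀ ℕ) : IsLeadExp (monomial d (1 : ℂ)) d := by
  classical
  constructor
  · simp
  · intro e he hne
    simp [coeff_monomial] at he
    exact absurd he.symm hne

theorem X_mul_X_eq_monomial (i j : Fin 5) :
    (X i * X j : MvPolynomial (Fin 5) ℂ)
      = monomial (Finsupp.single i 1 + Finsupp.single j 1) 1 := by
  simp [X, monomial_mul]

theorem single_add_single_le_iff {i j : Fin 5} (hij : i ≠ j) (e : Fin 5 →₀ ℕ) :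
    Finsupp.single i 1 + Finsupp.single j 1 ≤ e ↔ 0 < e i ∧ 0 < e j := by
  constructor
  · intro h
    have h1 := h i
    have h2 := h j
    simp [hij, hij.symm] at h1 h2
    omega
  · rintro ⟨h1, h2⟩ k
    simp only [Finsupp.add_apply, Finsupp.single_apply]
    by_cases hi : i = k <;> by_cases hj : j = k <;> simp_all <;> omega

theorem mem_span_quadrics_iff (p : MvPolynomial (Fin 5) ℂ) :
    p ∈ Ideal.span ({X 1 * X 4, X 0 * X 4, X 1 * X 3, X 0 * X 3} :
        Set (MvPolynomial (Fin 5) ℂ)) ↔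
      ∀ e ∈ p.support, (0 < e 0 ∨ 0 < e 1) ∧ (0 < e 3 ∨ 0 < e 4) := by
  simp only [X_mul_X_eq_monomial]
  have := mem_ideal_span_monomial_image (x := p) (s := {Finsupp.single 1 1 + Finsupp.single 4 1,
    Finsupp.single 0 1 + Finsupp.single 4 1, Finsupp.single 1 1 + Finsupp.single 3 1,
    Finsupp.single 0 1 + Finsupp.single 3 1})
  simp only [Set.image_insert_eq, Set.image_singleton] at this
  rw [this]
  refine forall₂_congr fun e _ => ?_
  simp [single_add_single_le_iff]
  tauto

theorem exists_eq_mul_add_of_mem_span {f h : MvPolynomial (Fin 5) ℂ}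
    (hf : ∀ e ∈ f.support, 0 < e 0 ∨ 0 < e 1)
    (hh : h ∈ Ideal.span ({X 1 * X 4, X 0 * X 4, X 1 * X 3, X 0 * X 3, f} :
      Set (MvPolynomial (Fin 5) ℂ))) :
    ∃ g m : MvPolynomial (Fin 5) ℂ, h = g * f + m ∧ (∀ e ∈ g.support, e 3 = 0 ∧ e 4 = 0) ∧
      ∀ e ∈ m.support, (0 < e 0 ∨ 0 < e 1) ∧ (0 < e 3 ∨ 0 < e 4) := by
  classical
  have hset : ({X 1 * X 4, X 0 * X 4, X 1 * X 3, X 0 * X 3, f} : Set (MvPolynomial (Fin 5) ℂ))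
      = insert f {X 1 * X 4, X 0 * X 4, X 1 * X 3, X 0 * X 3} := by
    ext p
    simp only [Set.mem_insert_iff, Set.mem_singleton_iff]
    tauto
  rw [hset, Ideal.mem_span_insert] at hh
  obtain ⟨a, m, hm, rfl⟩ := hh
  suffices H : ∃ g : MvPolynomial (Fin 5) ℂ, (∀ e ∈ g.support, e 3 = 0 ∧ e 4 = 0) ∧
      a * f - g * f ∈ Ideal.span ({X 1 * X 4, X 0 * X 4, X 1 * X 3, X 0 * X 3} :
        Set (MvPolynomial (Fin 5) ℂ)) by
    obtain ⟨g, hg, hgm⟩ := H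
    exact ⟨g, a * f - g * f + m, by ring, hg,
      (mem_span_quadrics_iff _).mp (Ideal.add_mem _ hgm hm)⟩
  induction a using MvPolynomial.induction_on' with
  | monomial u c =>
    by_cases hu : u 3 = 0 ∧ u 4 = 0
    · refine ⟨monomial u c, fun e he => ?_, by simp⟩
      rw [Finset.mem_singleton.mp (support_monomial_subset he)]
      exact hu
    · refine ⟨0, by simp, ?_⟩
      rw [zero_mul, sub_zero, mem_span_quadrics_iff]
      intro e he
      obtain ⟨u', hu', v, hv, rfl⟩ := Finset.mem_add.mp (support_mul _ _ he)
      obtain rfl := Finset.mem_singleton.mp (support_monomial_subset hu')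
      have := hf v hv
      simp only [Finsupp.add_apply]
      omega
  | add p q hp hq =>
    obtain ⟨g, hg, hgm⟩ := hp
    obtain ⟨g', hg', hgm'⟩ := hq
    refine ⟨g + g', fun e he => ?_, ?_⟩
    · rcases Finset.mem_union.mp (support_add he) with he | he
      · exact hg e he
      · exact hg' e he
    · convert Ideal.add_mem _ hgm hgm' using 1
      ring

/-- Let `f` be a nonzero homogeneous quintic in `x₀,x₁,x₂` only with
zero coefficient of `x₂⁵`.  Then the initial ideal of `(x₁x₄, x₀x₄, x₁x₃, x₀x₃, f)`
with respect to degrevlex is `(x₁x₄, x₀x₄, x₁x₃, x₀x₃, lm f)`. -/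
theorem stmt_12 (f : MvPolynomial (Fin 5) ℂ) (hf0 : f ≠ 0)
    (hf5 : f.IsHomogeneous 5)
    (hfvars : ∀ e ∈ f.support, e 3 = 0 ∧ e 4 = 0)
    (hfx2 : coeff (Finsupp.single 2 5) f = 0)
    (df : Fin 5 →₀ ℕ) (hdf : IsLeadExp f df) :
    initialIdeal (Ideal.span {X 1 * X 4, X 0 * X 4, X 1 * X 3, X 0 * X 3, f})
      = Ideal.span {X 1 * X 4, X 0 * X 4, X 1 * X 3, X 0 * X 3,
          monomial df (1 : ℂ)} := by
  have hf01 : ∀ e ∈ f.support, 0 < e 0 ∨ 0 < e 1 := by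
    intro e he
    by_contra hcon
    have h34 := hfvars e he
    have hdeg : e.degree = 5 := (hf5.degree_eq_sum_deg_support he).symm
    have h2 : e = Finsupp.single 2 5 := by
      rw [Finsupp.degree_eq_sum, Fin.sum_univ_five] at hdeg
      ext i
      fin_cases i <;> simp <;> omega
    exact mem_support_iff.mp he (h2 ▸ hfx2)
  apply le_antisymm
  · refine Ideal.span_le.mpr ?_
    rintro _ ⟨h, hh, d, hd, rfl⟩
    obtain ⟨g, m, rfl, hg, hm⟩ := exists_eq_mul_add_of_mem_span hf01 hh
    by_cases hdm : d ∈ m.support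
    · have hmem : monomial d (1 : ℂ) ∈ Ideal.span ({X 1 * X 4, X 0 * X 4, X 1 * X 3, X 0 * X 3} :
          Set (MvPolynomial (Fin 5) ℂ)) := by
        rw [mem_span_quadrics_iff]
        intro e he
        rw [Finset.mem_singleton.mp (support_monomial_subset he)]
        exact hm d hdm
      refine Ideal.span_mono ?_ hmem
      intro p hp
      simp only [Set.mem_insert_iff, Set.mem_singleton_iff] at hp ⊢
      tauto
    · have hdgf : d ∈ (g * f).support := by
        have h1 := hd.1
        rw [notMem_support_iff] at hdm
        rwa [mem_support_iff, coeff_add, hdm, add_zero, ← mem_support_iff] at h1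
      have hg0 : g ≠ 0 := by
        rintro rfl
        simp at hdgf
      obtain ⟨e, he⟩ := exists_isLeadExp hg0
      have hlead := he.mul hdf
      have hem : coeff (e + df) m = 0 := by
        by_contra h0
        have h1 := (hm _ (mem_support_iff.mpr h0)).2
        have h2 := hg e he.1
        have h3 := hfvars df hdf.1
        simp only [Finsupp.add_apply] at h1
        omega
      have hsupp : e + df ∈ (g * f + m).support := by
        rw [mem_support_iff, coeff_add, hem, add_zero, ← mem_support_iff]
        exact hlead.1
      have hde : d = e + df := by
        by_contra hne
        exact revLexLT_asymm (hlead.2 d hdgf hne) (hd.2 _ hsupp (Ne.symm hne))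
      rw [hde, SetLike.mem_coe, ← mul_one (1 : ℂ), ← monomial_mul, mul_one]
      exact Ideal.mul_mem_left _ _ (Ideal.subset_span (by simp))
  · have hquad (i j : Fin 5)
        (hij : X i * X j ∈ Ideal.span {X 1 * X 4, X 0 * X 4, X 1 * X 3, X 0 * X 3, f}) :
        X i * X j ∈ initialIdeal (Ideal.span {X 1 * X 4, X 0 * X 4, X 1 * X 3, X 0 * X 3, f}) :=
      Ideal.subset_span ⟨_, hij, _, X_mul_X_eq_monomial i j ▸ isLeadExp_monomial _,
        X_mul_X_eq_monomial i j⟩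
    refine Ideal.span_le.mpr ?_
    rintro p (rfl | rfl | rfl | rfl | rfl)
    iterate 4 exact hquad _ _ (Ideal.subset_span (by simp))
    exact Ideal.subset_span ⟨f, Ideal.subset_span (by simp), df, hdf, rfl⟩
end

section
/- Let I ⊆ ℂ[x₀,x₁,x₂,x₃,x₄] be the ideal generated by the monomials x₀², x₀x₁, x₀x₂, x₁³, x₁²x₂², x₁x₂³, x₂⁴. Then for every integer m ≥ 3, the number of monomials of total degree m in x₀,…,x₄ that do not belong to I equals 10m − 8. (This computes the Hilbert function of the cone over the scheme defined by Borel(x₀x₂) + Borel(x₂⁴) + (x₁³), showing that the cone has degree 10 and arithmetic genus g_Γ = 9, since 10m − 8 = 10m + 1 − g_Γ.) -/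
open MvPolynomial

/-- Membership of a monomial in the monomial ideal, as divisibility by one of the generators. -/
theorem monomial_mem_borel_ideal_iff (e : Fin 5 →₀ ℕ) :
    monomial e (1 : ℂ) ∈ Ideal.span ({X 0 ^ 2, X 0 * X 1, X 0 * X 2, X 1 ^ 3,
      X 1 ^ 2 * X 2 ^ 2, X 1 * X 2 ^ 3, X 2 ^ 4} : Set (MvPolynomial (Fin 5) ℂ)) ↔
    2 ≤ e 0 ∨ (1 ≤ e 0 ∧ 1 ≤ e 1) ∨ (1 ≤ e 0 ∧ 1 ≤ e 2) ∨ 3 ≤ e 1 ∨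
      (2 ≤ e 1 ∧ 2 ≤ e 2) ∨ (1 ≤ e 1 ∧ 3 ≤ e 2) ∨ 4 ≤ e 2 := by
  have h : ({X 0 ^ 2, X 0 * X 1, X 0 * X 2, X 1 ^ 3,
      X 1 ^ 2 * X 2 ^ 2, X 1 * X 2 ^ 3, X 2 ^ 4} : Set (MvPolynomial (Fin 5) ℂ)) =
      (fun s => monomial s (1 : ℂ)) '' {Finsupp.single 0 2,
        Finsupp.single 0 1 + Finsupp.single 1 1, Finsupp.single 0 1 + Finsupp.single 2 1,
        Finsupp.single 1 3, Finsupp.single 1 2 + Finsupp.single 2 2,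
        Finsupp.single 1 1 + Finsupp.single 2 3, Finsupp.single 2 4} := by
    simp only [Set.image_insert_eq, Set.image_singleton, X, monomial_pow, monomial_mul,
      Finsupp.smul_single, smul_eq_mul, one_pow, mul_one]
  rw [h, mem_ideal_span_monomial_image]
  simp [Finsupp.le_def, Fin.forall_fin_succ, Fin.ext_iff]

/-- The exponents of the monomials in `x₀, x₁, x₂` outside the ideal. -/
def standardExponents : Finset (ℕ × ℕ × ℕ) :=
  {(1, 0, 0), (0, 0, 0), (0, 0, 1), (0, 0, 2), (0, 0, 3), (0, 1, 0), (0, 1, 1), (0, 1, 2),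
    (0, 2, 0), (0, 2, 1)}

theorem mem_standardExponents_iff (a b c : ℕ) :
    (a, b, c) ∈ standardExponents ↔
      ¬(2 ≤ a ∨ (1 ≤ a ∧ 1 ≤ b) ∨ (1 ≤ a ∧ 1 ≤ c) ∨ 3 ≤ b ∨
        (2 ≤ b ∧ 2 ≤ c) ∨ (1 ≤ b ∧ 3 ≤ c) ∨ 4 ≤ c) := by
  simp only [standardExponents, Finset.mem_insert, Finset.mem_singleton, Prod.mk.injEq]
  by_cases h : a < 2 ∧ b < 3 ∧ c < 4
  · obtain ⟨ha, hb, hc⟩ := h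
    interval_cases a <;> interval_cases b <;> interval_cases c <;> simp
  · exact iff_of_false (by intro h'; apply h; omega) (by intro h'; apply h; omega)

/-- Let `I ⊆ ℂ[x₀,…,x₄]` be the ideal generated by the monomials
`x₀², x₀x₁, x₀x₂, x₁³, x₁²x₂², x₁x₂³, x₂⁴`.  Then for every `m ≥ 3`, the number of
monomials of total degree `m` in `x₀,…,x₄` not belonging to `I` equals `10m − 8`. -/
theorem stmt_17 (I : Ideal (MvPolynomial (Fin 5) ℂ))
    (hI : I = Ideal.span {X 0 ^ 2, X 0 * X 1, X 0 * X 2, X 1 ^ 3,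
      X 1 ^ 2 * X 2 ^ 2, X 1 * X 2 ^ 3, X 2 ^ 4}) :
    ∀ m : ℕ, 3 ≤ m →
      {e : Fin 5 →₀ ℕ | (e.sum fun _ n => n) = m ∧ monomial e (1 : ℂ) ∉ I}.ncard
        = 10 * m - 8 := by
  intro m hm
  subst hI
  simp only [monomial_mem_borel_ideal_iff, ← mem_standardExponents_iff]
  have hsum (e : Fin 5 →₀ ℕ) : (e.sum fun _ n => n) = e 0 + e 1 + e 2 + e 3 + e 4 := by
    rw [Finsupp.sum_fintype _ _ (fun _ => rfl), Fin.sum_univ_five]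
  simp only [hsum]
  let T : Finset (Σ _ : ℕ × ℕ × ℕ, ℕ) :=
    standardExponents.sigma fun s => Finset.range (m + 1 - (s.1 + s.2.1 + s.2.2))
  have hT : T.card = 10 * m - 8 := by
    simp [T, standardExponents, Finset.card_sigma]
    omega
  rw [← hT, ← Set.ncard_coe_finset]
  refine Set.ncard_congr (fun e _ => ⟨(e 0, e 1, e 2), e 3⟩) ?_ ?_ ?_
  · rintro e ⟨he, hs⟩
    simp only [T, Finset.mem_coe, Finset.mem_sigma, Finset.mem_range]
    exact ⟨hs, by omega⟩
  · rintro e f ⟨he, -⟩ ⟨hf, -⟩ h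
    simp only [Sigma.mk.injEq, Prod.mk.injEq, heq_eq_eq] at h
    ext i
    fin_cases i <;> simp <;> omega
  · rintro ⟨⟨a, b, c⟩, d⟩ h
    simp only [T, Finset.mem_coe, Finset.mem_sigma, Finset.mem_range] at h
    refine ⟨Finsupp.equivFunOnFinite.symm ![a, b, c, d, m - (a + b + c + d)], ⟨?_, ?_⟩, ?_⟩
    · simp
      omega
    · simpa using h.1
    · simp
end
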